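/- Let X be an n×p real matrix, β ∈ ℝ^p, ε ∈ ℝⁿ, Y = Xβ + ε, let β_init be a Lasso minimizer with penalty λ_n > 0, and suppose ‖Xᵀε/n‖_∞ ≤ λ_n/2. Let T₀ ⊆ {1,…,p} with |T₀| ≤ s₀, β₀ = β_{T₀}, h = β_init − β₀, δ = β_init − β. Suppose additionally that ‖Xδ‖₂²/n + ‖Xh‖₂²/n ≥ ‖X(β − β₀)‖₂²/n. Then ‖h_{T₀^c}‖₁ ≤ 3·‖h_{T₀}‖₁. If moreover X satisfies RE(s₀,3,X) with constant K = K(s₀,3), then ‖h_{T₀}‖₂ ≤ K·‖X(β − β₀)‖₂/√n + 3K²·λ_n·√s₀ and ‖Xδ‖₂²/n + λ_n·‖h_{T₀^c}‖₁ ≤ ‖X(β − β₀)‖₂²/n + (3K·λ_n·√s₀/2)². -/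

import Mathlib

open Finset Matrix Real
open scoped BigOperators Classical

noncomputable section

namespace ThreshLasso

/-- ℓ₂ norm of a finite real vector. -/
def l2 {m : ℕ} (v : Fin m → ℝ) : ℝ := Real.sqrt (∑ i, (v i) ^ 2)

/-- ℓ₁ norm of a finite real vector. -/
def l1 {m : ℕ} (v : Fin m → ℝ) : ℝ := ∑ i, |v i|

/-- Restriction of a vector to a set of coordinates (zero outside). -/
def restr {p : ℕ} (v : Fin p → ℝ) (T : Finset (Fin p)) : Fin p → ℝ :=
  fun j => if j ∈ T then v j else 0

/-- Support of a vector, as a `Finset`. -/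
def supp {p : ℕ} (v : Fin p → ℝ) : Finset (Fin p) :=
  Finset.univ.filter fun j => v j ≠ 0

/-- `L` is the minimal `m`-sparse eigenvalue `Λ_min(m)` of `X`:
the least value of `‖Xv‖₂²/(n‖v‖₂²)` over nonzero `v` with at most `m`
nonzero coordinates. -/
def IsLambdaMin {n p : ℕ} (X : Matrix (Fin n) (Fin p) ℝ) (m : ℕ) (L : ℝ) : Prop :=
  IsLeast {r : ℝ | ∃ v : Fin p → ℝ, v ≠ 0 ∧ (supp v).card ≤ m ∧
    r = (l2 (X.mulVec v)) ^ 2 / (n * (l2 v) ^ 2)} L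

/-- `L` is the maximal `m`-sparse eigenvalue `Λ_max(m)` of `X`
(with the convention `Λ_max(0) = 0`, implemented by inserting `0` in the set,
which does not change the maximum when `m ≥ 1`). -/
def IsLambdaMax {n p : ℕ} (X : Matrix (Fin n) (Fin p) ℝ) (m : ℕ) (L : ℝ) : Prop :=
  IsGreatest (insert (0 : ℝ) {r : ℝ | ∃ v : Fin p → ℝ, v ≠ 0 ∧ (supp v).card ≤ m ∧
    r = (l2 (X.mulVec v)) ^ 2 / (n * (l2 v) ^ 2)}) L

/-- `θ` is the restricted orthogonality constant `θ_{m,m'}` of `X`: the smallest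
nonnegative `t` such that `|⟨Xu, Xu'⟩|/n ≤ t‖u‖₂‖u'‖₂` for all `u, u'` supported
on disjoint sets of cardinality at most `m`, `m'` respectively. -/
def IsTheta {n p : ℕ} (X : Matrix (Fin n) (Fin p) ℝ) (m m' : ℕ) (θ : ℝ) : Prop :=
  IsLeast {t : ℝ | 0 ≤ t ∧ ∀ (u u' : Fin p → ℝ) (T T' : Finset (Fin p)),
    Disjoint T T' → T.card ≤ m → T'.card ≤ m' →
    (∀ j, j ∉ T → u j = 0) → (∀ j, j ∉ T' → u' j = 0) →
    |∑ i, (X.mulVec u i) * (X.mulVec u' i)| / n ≤ t * (l2 u * l2 u')} θ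

/-- Restricted eigenvalue condition `RE(s₀, k₀, X)` with constant `K`. -/
def RECond {n p : ℕ} (X : Matrix (Fin n) (Fin p) ℝ) (s₀ : ℕ) (k₀ K : ℝ) : Prop :=
  0 < K ∧ ∀ (v : Fin p → ℝ) (J : Finset (Fin p)), J.card ≤ s₀ →
    l1 (restr v Jᶜ) ≤ k₀ * l1 (restr v J) →
    l2 (restr v J) / K ≤ l2 (X.mulVec v) / Real.sqrt n

/-- `s₀` is the essential sparsity of `β`: the smallest nonnegative integer `m`
with `∑ᵢ min(βᵢ², λ²σ²) ≤ m λ²σ²`. -/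
def EssSparsity {p : ℕ} (β : Fin p → ℝ) (lam σ : ℝ) (s₀ : ℕ) : Prop :=
  IsLeast {m : ℕ | ∑ i, min ((β i) ^ 2) (lam ^ 2 * σ ^ 2) ≤ (m : ℝ) * (lam ^ 2 * σ ^ 2)} s₀

/-- `T₀` is a set of indices of the `s₀` largest coordinates of `β` in absolute value. -/
def TopSet {p : ℕ} (β : Fin p → ℝ) (s₀ : ℕ) (T₀ : Finset (Fin p)) : Prop :=
  T₀.card = s₀ ∧ ∀ i ∈ T₀, ∀ j, j ∉ T₀ → |β j| ≤ |β i|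

/-- `T₁` is a set of indices of the `s₀` largest coordinates of `h` in absolute
value outside `T₀`. -/
def TopSetOutside {p : ℕ} (h : Fin p → ℝ) (s₀ : ℕ) (T₀ T₁ : Finset (Fin p)) : Prop :=
  T₁.card = s₀ ∧ Disjoint T₀ T₁ ∧
    ∀ i ∈ T₁, ∀ j, j ∉ T₀ → j ∉ T₁ → |h j| ≤ |h i|

/-- `b` is a Lasso minimizer with penalty `lamn` for data `(X, Y)`. -/
def IsLassoSol {n p : ℕ} (X : Matrix (Fin n) (Fin p) ℝ) (Y : Fin n → ℝ)
    (lamn : ℝ) (b : Fin p → ℝ) : Prop :=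
  ∀ b' : Fin p → ℝ,
    1 / (2 * n) * (l2 (Y - X.mulVec b)) ^ 2 + lamn * l1 b ≤
    1 / (2 * n) * (l2 (Y - X.mulVec b')) ^ 2 + lamn * l1 b'

/-- Submatrix of the columns of `X` indexed by `I`. -/
def colSub {n p : ℕ} (X : Matrix (Fin n) (Fin p) ℝ) (I : Finset (Fin p)) :
    Matrix (Fin n) {j // j ∈ I} ℝ :=
  Matrix.of fun i j => X i j.1

/-- The Gram matrix `X_Iᵀ X_I` is invertible. -/
def GramInvertible {n p : ℕ} (X : Matrix (Fin n) (Fin p) ℝ) (I : Finset (Fin p)) : Prop :=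
  IsUnit ((colSub X I)ᵀ * colSub X I).det

/-- The OLS refit of `Y` on the columns of `X` indexed by `I`:
`(X_Iᵀ X_I)⁻¹ X_Iᵀ Y` on `I`, and `0` off `I`. -/
def olsRefit {n p : ℕ} (X : Matrix (Fin n) (Fin p) ℝ) (Y : Fin n → ℝ)
    (I : Finset (Fin p)) : Fin p → ℝ :=
  fun j => if h : j ∈ I then
    (((colSub X I)ᵀ * colSub X I)⁻¹).mulVec ((colSub X I)ᵀ.mulVec Y) ⟨j, h⟩
  else 0


lemma l2_sq {m : ℕ} (v : Fin m → ℝ) : l2 v ^ 2 = v ⬝ᵥ v := by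
  rw [l2, Real.sq_sqrt (Finset.sum_nonneg fun i _ => sq_nonneg (v i))]
  simp only [dotProduct, sq]

lemma l2_nonneg {m : ℕ} (v : Fin m → ℝ) : 0 ≤ l2 v := Real.sqrt_nonneg _

/-- Cauchy–Schwarz for a vector restricted to at most `s` coordinates. -/
lemma l1_restr_le {p s : ℕ} (v : Fin p → ℝ) (T : Finset (Fin p)) (hT : T.card ≤ s) :
    l1 (restr v T) ≤ √s * l2 (restr v T) := by
  have h1 : l1 (restr v T) = ∑ j ∈ T, |v j| := by
    simp [l1, restr, apply_ite abs]
  have h2 : ∑ j, (restr v T j) ^ 2 = ∑ j ∈ T, |v j| ^ 2 := by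
    simp [restr, ite_pow]
  rw [h1, l2, h2, ← Real.sqrt_mul (Nat.cast_nonneg s)]
  refine Real.le_sqrt_of_sq_le (sq_sum_le_card_mul_sum_sq.trans ?_)
  gcongr

/-- Hölder's inequality for the noise term. -/
lemma dotProduct_mulVec_div_le {n p : ℕ} (X : Matrix (Fin n) (Fin p) ℝ) (ε : Fin n → ℝ)
    {c : ℝ} (hnoise : ∀ j, |(∑ i, X i j * ε i) / n| ≤ c) (v : Fin p → ℝ) :
    (ε ⬝ᵥ X *ᵥ v) / n ≤ c * l1 v := by
  have h1 : (ε ⬝ᵥ X *ᵥ v) / n = ∑ j, (∑ i, X i j * ε i) / n * v j := by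
    rw [dotProduct_mulVec, dotProduct, Finset.sum_div]
    refine Finset.sum_congr rfl fun j _ => ?_
    simp only [vecMul, dotProduct, mul_comm (ε _)]
    ring
  rw [h1, l1, Finset.mul_sum]
  refine Finset.sum_le_sum fun j _ => (le_abs_self _).trans ?_
  rw [abs_mul]
  exact mul_le_mul_of_nonneg_right (hnoise j) (abs_nonneg _)

lemma l1_convex_le {p : ℕ} (b c : Fin p → ℝ) {t : ℝ} (h0 : 0 ≤ t) (h1 : t ≤ 1) :
    l1 (b + t • (c - b)) ≤ (1 - t) * l1 b + t * l1 c := by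
  simp only [l1, Finset.mul_sum, ← Finset.sum_add_distrib]
  refine Finset.sum_le_sum fun j _ => ?_
  have h2 : (b + t • (c - b)) j = (1 - t) * b j + t * c j := by
    simp only [Pi.add_apply, Pi.smul_apply, Pi.sub_apply, smul_eq_mul]
    ring
  rw [h2]
  refine (abs_add_le _ _).trans_eq ?_
  rw [abs_mul, abs_mul, abs_of_nonneg h0, abs_of_nonneg (sub_nonneg.2 h1)]

/-- First-order optimality of a Lasso minimizer in the direction of a competitor. -/
lemma IsLassoSol.optimality {n p : ℕ} {X : Matrix (Fin n) (Fin p) ℝ} {Y : Fin n → ℝ}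
    {lamn : ℝ} {b : Fin p → ℝ} (hlamn : 0 ≤ lamn) (hb : IsLassoSol X Y lamn b)
    (c : Fin p → ℝ) :
    ((Y - X *ᵥ b) ⬝ᵥ X *ᵥ (c - b)) / n ≤ lamn * (l1 c - l1 b) := by
  set r := Y - X *ᵥ b with hr
  set w := X *ᵥ (c - b) with hw
  have key : ∀ t : ℝ, 0 < t → t ≤ 1 →
      (r ⬝ᵥ w) / n ≤ lamn * (l1 c - l1 b) + t * ((w ⬝ᵥ w) / (2 * n)) := by
    intro t h0 h1
    have hmin := hb (b + t • (c - b))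
    have hres : Y - X *ᵥ (b + t • (c - b)) = r - t • w := by
      rw [mulVec_add, mulVec_smul, hr, hw]
      abel
    have hpen := mul_le_mul_of_nonneg_left (l1_convex_le b c h0.le h1) hlamn
    rw [hres, ← hr, l2_sq, l2_sq] at hmin
    simp only [sub_dotProduct, dotProduct_sub, smul_dotProduct, dotProduct_smul, smul_eq_mul,
      dotProduct_comm w r] at hmin
    refine le_of_mul_le_mul_left ?_ h0
    have e : 1 / (2 * (n : ℝ)) * (r ⬝ᵥ r - t * (r ⬝ᵥ w) - t * ((r ⬝ᵥ w) - t * (w ⬝ᵥ w))) =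
        1 / (2 * (n : ℝ)) * (r ⬝ᵥ r) - t * ((r ⬝ᵥ w) / n) + t * (t * ((w ⬝ᵥ w) / (2 * n))) := by
      ring
    rw [e] at hmin
    linarith
  have hlim : Filter.Tendsto
      (fun t : ℝ => lamn * (l1 c - l1 b) + t * ((w ⬝ᵥ w) / (2 * n)))
      (nhdsWithin 0 (Set.Ioi 0)) (nhds (lamn * (l1 c - l1 b))) := by
    refine tendsto_nhdsWithin_of_tendsto_nhds ?_
    have hc : Continuous fun t : ℝ => lamn * (l1 c - l1 b) + t * ((w ⬝ᵥ w) / (2 * n)) := by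
      fun_prop
    simpa using hc.tendsto 0
  refine ge_of_tendsto hlim ?_
  filter_upwards [Ioc_mem_nhdsGT (zero_lt_one' ℝ)] with t ht
  exact key t ht.1 ht.2

lemma l1_restr_penalty_le {p : ℕ} (β b : Fin p → ℝ) (T : Finset (Fin p)) :
    2 * (l1 (restr β T) - l1 b) + l1 (b - restr β T) ≤
      3 * l1 (restr (b - restr β T) T) - l1 (restr (b - restr β T) Tᶜ) := by
  simp only [l1, Finset.mul_sum, ← Finset.sum_sub_distrib, ← Finset.sum_add_distrib]
  refine Finset.sum_le_sum fun j _ => ?_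
  by_cases hj : j ∈ T
  · have := abs_sub_abs_le_abs_sub (β j) (b j)
    rw [abs_sub_comm] at this
    simp only [restr, hj, Finset.mem_compl, Pi.sub_apply, if_true, not_true_eq_false, if_false,
      abs_zero]
    linarith
  · simp only [restr, hj, Finset.mem_compl, Pi.sub_apply, if_true, not_false_eq_true, if_false,
      abs_zero, sub_zero]
    linarith

/-- The basic inequality for a Lasso minimizer compared with a restriction of the truth. -/
lemma IsLassoSol.basic_inequality {n p : ℕ} {X : Matrix (Fin n) (Fin p) ℝ}
    {β b : Fin p → ℝ} {ε : Fin n → ℝ} {lamn : ℝ} (hlamn : 0 ≤ lamn)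
    (hb : IsLassoSol X (X *ᵥ β + ε) lamn b)
    (hnoise : ∀ j, |(∑ i, X i j * ε i) / n| ≤ lamn / 2) (T : Finset (Fin p)) :
    l2 (X *ᵥ (b - β)) ^ 2 / n + l2 (X *ᵥ (b - restr β T)) ^ 2 / n
        + lamn * l1 (restr (b - restr β T) Tᶜ) ≤
      l2 (X *ᵥ (β - restr β T)) ^ 2 / n + 3 * lamn * l1 (restr (b - restr β T) T) := by
  have hopt := hb.optimality hlamn (restr β T)
  have hnz := dotProduct_mulVec_div_le X ε hnoise (b - restr β T)
  have hpen := mul_le_mul_of_nonneg_left (l1_restr_penalty_le β b T) hlamn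
  set d := X *ᵥ (b - β) with hd
  set e := X *ᵥ (b - restr β T) with he
  have e1 : X *ᵥ β + ε - X *ᵥ b = ε - d := by rw [hd, mulVec_sub]; abel
  have e2 : X *ᵥ (restr β T - b) = -e := by rw [he, ← mulVec_neg, neg_sub]
  have e3 : X *ᵥ (β - restr β T) = e - d := by rw [hd, he, ← mulVec_sub]; congr 1; abel
  rw [e1, e2] at hopt
  rw [e3, l2_sq, l2_sq, l2_sq]
  simp only [sub_dotProduct, dotProduct_sub, dotProduct_neg, dotProduct_comm e d, neg_div,
    sub_div] at hopt ⊢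
  linarith

/-- Case 1 of the Lasso analysis: cone membership and bounds
under RE(s₀,3,X). -/
theorem statement_16
    (n p s₀ : ℕ) (hn : 0 < n)
    (X : Matrix (Fin n) (Fin p) ℝ) (β : Fin p → ℝ) (ε Y : Fin n → ℝ)
    (hY : Y = X.mulVec β + ε)
    (lamn : ℝ) (hlamn : 0 < lamn)
    (βinit : Fin p → ℝ) (hinit : IsLassoSol X Y lamn βinit)
    (hnoise : ∀ j, |(∑ i, X i j * ε i) / n| ≤ lamn / 2)
    (T₀ : Finset (Fin p)) (hT₀ : T₀.card ≤ s₀)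
    (β₀ h δ : Fin p → ℝ) (hβ₀ : β₀ = restr β T₀)
    (hh : h = βinit - β₀) (hδ : δ = βinit - β)
    (hcase : (l2 (X.mulVec (β - β₀))) ^ 2 / n ≤
      (l2 (X.mulVec δ)) ^ 2 / n + (l2 (X.mulVec h)) ^ 2 / n)
    (K : ℝ) :
    l1 (restr h T₀ᶜ) ≤ 3 * l1 (restr h T₀) ∧
    (RECond X s₀ 3 K →
      l2 (restr h T₀) ≤ K * (l2 (X.mulVec (β - β₀)) / Real.sqrt n) +
        3 * K ^ 2 * lamn * Real.sqrt s₀ ∧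
      (l2 (X.mulVec δ)) ^ 2 / n + lamn * l1 (restr h T₀ᶜ) ≤
        (l2 (X.mulVec (β - β₀))) ^ 2 / n + (3 * K * lamn * Real.sqrt s₀ / 2) ^ 2) := by
  subst hY hβ₀ hh hδ
  have hbasic := hinit.basic_inequality hlamn.le hnoise T₀
  have hcone : l1 (restr (βinit - restr β T₀) T₀ᶜ) ≤ 3 * l1 (restr (βinit - restr β T₀) T₀) := by
    refine le_of_mul_le_mul_left ?_ hlamn
    linarith
  refine ⟨hcone, fun ⟨hK, hRE⟩ => ?_⟩
  have hre := hRE _ T₀ hT₀ hcone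
  have hcs := l1_restr_le (βinit - restr β T₀) T₀ hT₀
  have hcompl : 0 ≤ l1 (restr (βinit - restr β T₀) T₀ᶜ) :=
    Finset.sum_nonneg fun _ _ => abs_nonneg _
  have hsq : ∀ v : Fin n → ℝ, l2 v ^ 2 / n = (l2 v / √n) ^ 2 := fun v => by
    rw [div_pow, Real.sq_sqrt (Nat.cast_nonneg n)]
  have hnonneg : ∀ v : Fin n → ℝ, 0 ≤ l2 v / √n := fun v =>
    div_nonneg (l2_nonneg v) (Real.sqrt_nonneg _)
  simp only [hsq] at hbasic ⊢
  set H := l2 (X *ᵥ (βinit - restr β T₀)) / √n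
  set B := l2 (X *ᵥ (β - restr β T₀)) / √n
  have hB : 0 ≤ B := hnonneg _
  rw [div_le_iff₀' hK] at hre
  have hl1 : 3 * lamn * l1 (restr (βinit - restr β T₀) T₀) ≤ 3 * K * lamn * √s₀ * H := by
    calc _ ≤ 3 * lamn * (√s₀ * (K * H)) := by gcongr; exact hcs.trans (by gcongr)
      _ = _ := by ring
  have hc : 0 ≤ 3 * K * lamn * √s₀ := by positivity
  set c := 3 * K * lamn * √s₀ with hcdef
  constructor
  · have hHB : H ≤ B + c := by
      by_contra! hlt
      nlinarith [mul_nonneg hlamn.le hcompl, sq_nonneg (l2 (X *ᵥ (βinit - β)) / √n)]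
    calc _ ≤ K * H := hre
      _ ≤ K * (B + c) := by gcongr
      _ = _ := by rw [hcdef]; ring
  · nlinarith [sq_nonneg (H - c / 2)]

end ThreshLasso
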